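/- Let n ∈ H satisfy ⟨n, ∂ᵢp(λ_o)⟩ = 0 for all i = 1,…,d and set ν = ‖n‖. Let v ∈ ℝᵈ be the vector with components vⱼ = ⟨n, ∂ⱼp(λ_r)⟩. Then ‖ G(λ_r)⁻¹ v ‖ ≤ K · √d · ν · η_min(G(λ_r))⁻¹ · ‖λ_r − λ_o‖₁; that is, the contribution of the noise to the tangent distance estimate is controlled by the curvature bound, the noise level, and the parameter-domain distance between the reference and optimal parameters. -/

import Mathlib

open scoped RealInnerProductSpace BigOperators

/-- The `i`-th partial derivative `∂ᵢp(x) ∈ H` of a map `p : ℝᵈ → H`. -/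
noncomputable def pderiv {H : Type*} [NormedAddCommGroup H] [NormedSpace ℝ H] {d : ℕ}
    (p : EuclideanSpace ℝ (Fin d) → H) (i : Fin d) (x : EuclideanSpace ℝ (Fin d)) : H :=
  fderiv ℝ p x (EuclideanSpace.single i 1)

/-- The second partial derivative `∂ᵢⱼp(x) ∈ H`. -/
noncomputable def pderiv2 {H : Type*} [NormedAddCommGroup H] [NormedSpace ℝ H] {d : ℕ}
    (p : EuclideanSpace ℝ (Fin d) → H) (i j : Fin d) (x : EuclideanSpace ℝ (Fin d)) : H :=
  fderiv ℝ (fun y => pderiv p j y) x (EuclideanSpace.single i 1)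

/-- The Gram (metric) matrix `G(x)ᵢⱼ = ⟨∂ᵢp(x), ∂ⱼp(x)⟩`. -/
noncomputable def gram {H : Type*} [NormedAddCommGroup H] [InnerProductSpace ℝ H] {d : ℕ}
    (p : EuclideanSpace ℝ (Fin d) → H) (x : EuclideanSpace ℝ (Fin d)) :
    Matrix (Fin d) (Fin d) ℝ :=
  Matrix.of fun i j => ⟪pderiv p i x, pderiv p j x⟫

/-- Smallest eigenvalue of a symmetric real matrix. -/
noncomputable def etaMin {d : ℕ} (A : Matrix (Fin d) (Fin d) ℝ) : ℝ :=
  if h : A.IsHermitian then ⨅ i, h.eigenvalues i else 0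


open scoped Matrix

theorem fderiv_eq_sum_pderiv {H : Type*} [NormedAddCommGroup H] [NormedSpace ℝ H] {d : ℕ}
    (f : EuclideanSpace ℝ (Fin d) → H) (x u : EuclideanSpace ℝ (Fin d)) :
    fderiv ℝ f x u = ∑ i, u i • pderiv f i x := by
  conv_lhs => rw [← (EuclideanSpace.basisFun (Fin d) ℝ).sum_repr u]
  simp [pderiv]

/-- A mean value inequality with respect to the `ℓ¹` norm of the increment. -/
theorem norm_sub_le_of_norm_pderiv_le {H : Type*} [NormedAddCommGroup H] [NormedSpace ℝ H] {d : ℕ}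
    {f : EuclideanSpace ℝ (Fin d) → H} (hf : Differentiable ℝ f) {a b : EuclideanSpace ℝ (Fin d)}
    {K : ℝ} (hK : ∀ i, ∀ x ∈ segment ℝ a b, ‖pderiv f i x‖ ≤ K) :
    ‖f a - f b‖ ≤ K * ∑ i, |a i - b i| := by
  have hderiv (t : ℝ) : HasDerivAt (fun s : ℝ => f (b + s • (a - b)))
      (fderiv ℝ f (b + t • (a - b)) (a - b)) t := by
    have hline : HasDerivAt (fun s : ℝ => b + s • (a - b)) (a - b) t := by
      simpa using ((hasDerivAt_id t).smul_const (a - b)).const_add b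
    exact (hf _).hasFDerivAt.comp_hasDerivAt t hline
  have hmvt := norm_image_sub_le_of_norm_deriv_le_segment_01' (C := K * ∑ i, |a i - b i|)
    (fun t _ => (hderiv t).hasDerivWithinAt) fun t ht => by
      have hmem : b + t • (a - b) ∈ segment ℝ a b := by
        rw [segment_symm, segment_eq_image']
        exact ⟨t, ⟨ht.1, ht.2.le⟩, rfl⟩
      rw [fderiv_eq_sum_pderiv, Finset.mul_sum]
      refine (norm_sum_le _ _).trans (Finset.sum_le_sum fun i _ => ?_)
      rw [norm_smul, mul_comm, PiLp.sub_apply, Real.norm_eq_abs]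
      exact mul_le_mul_of_nonneg_right (hK i _ hmem) (abs_nonneg _)
  simpa using hmvt

theorem differentiable_pderiv {H : Type*} [NormedAddCommGroup H] [NormedSpace ℝ H] {d : ℕ}
    {p : EuclideanSpace ℝ (Fin d) → H} (hp : ContDiff ℝ 2 p) (j : Fin d) :
    Differentiable ℝ (pderiv p j) :=
  ((hp.fderiv_right (m := 1) (by norm_num)).differentiable one_ne_zero).clm_apply
    (differentiable_const _)

theorem etaMin_le_eigenvalues {d : ℕ} {A : Matrix (Fin d) (Fin d) ℝ} (hA : A.IsHermitian)
    (i : Fin d) : etaMin A ≤ hA.eigenvalues i := by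
  rw [etaMin, dif_pos hA]
  exact ciInf_le (Set.finite_range _).bddBelow i

theorem etaMin_pos {d : ℕ} (hd : 0 < d) {A : Matrix (Fin d) (Fin d) ℝ} (hA : A.PosDef) :
    0 < etaMin A := by
  have : Nonempty (Fin d) := ⟨⟨0, hd⟩⟩
  rw [etaMin, dif_pos hA.isHermitian]
  obtain ⟨i, hi⟩ := exists_eq_ciInf_of_finite (f := hA.isHermitian.eigenvalues)
  rw [← hi]
  exact hA.eigenvalues_pos i

theorem etaMin_mul_norm_le {d : ℕ} {A : Matrix (Fin d) (Fin d) ℝ} (hA : A.IsHermitian)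
    (hη : 0 ≤ etaMin A) (w : Fin d → ℝ) :
    etaMin A * ‖WithLp.toLp 2 w‖ ≤ ‖WithLp.toLp 2 (A *ᵥ w)‖ := by
  have hcoord (i : Fin d) : ⟪hA.eigenvectorBasis i, WithLp.toLp 2 (A *ᵥ w)⟫ =
      hA.eigenvalues i * ⟪hA.eigenvectorBasis i, WithLp.toLp 2 w⟫ := by
    have hT : Aᵀ = A := by simpa using hA.eq
    simp only [EuclideanSpace.inner_eq_star_dotProduct, star_trivial]
    rw [dotProduct_comm, Matrix.dotProduct_mulVec, ← Matrix.mulVec_transpose, hT,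
      hA.mulVec_eigenvectorBasis, smul_dotProduct, smul_eq_mul, dotProduct_comm w]
  refine le_of_sq_le_sq ?_ (norm_nonneg _)
  rw [mul_pow, ← hA.eigenvectorBasis.sum_sq_norm_inner_right,
    ← hA.eigenvectorBasis.sum_sq_norm_inner_right, Finset.mul_sum]
  refine Finset.sum_le_sum fun i _ => ?_
  rw [hcoord, norm_mul, mul_pow, Real.norm_eq_abs (hA.eigenvalues i), sq_abs]
  gcongr
  exact etaMin_le_eigenvalues hA i

theorem norm_toLp_le_sqrt_mul {d : ℕ} {v : Fin d → ℝ} {C : ℝ} (hC : 0 ≤ C)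
    (hv : ∀ i, |v i| ≤ C) : ‖WithLp.toLp 2 v‖ ≤ √d * C := by
  rw [EuclideanSpace.norm_eq, ← Real.sqrt_sq hC, ← Real.sqrt_mul (Nat.cast_nonneg d)]
  refine Real.sqrt_le_sqrt ((Finset.sum_le_card_nsmul _ _ (C ^ 2) fun i _ => ?_).trans_eq ?_)
  · exact pow_le_pow_left₀ (norm_nonneg _) (hv i) 2
  · simp

/-- The noise contribution `‖G(λ_r)⁻¹ v‖` to the tangent distance estimate, where
`vⱼ = ⟨n, ∂ⱼp(λ_r)⟩`, is controlled via the curvature bound, the noise level, and the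
ℓ¹ distance between the reference and optimal parameters. -/
theorem noise_projection_bound
    {H : Type*} [NormedAddCommGroup H] [InnerProductSpace ℝ H]
    {d : ℕ} (hd : 0 < d)
    (p : EuclideanSpace ℝ (Fin d) → H) (hp : ContDiff ℝ 2 p)
    (lr lo : EuclideanSpace ℝ (Fin d))
    (K : ℝ) (hK : 0 ≤ K)
    (hKb : ∀ (i j : Fin d), ∀ x ∈ segment ℝ lr lo, ‖pderiv2 p i j x‖ ≤ K)
    (hPD : (gram p lr).PosDef)
    (n : H) (hn : ∀ i, ⟪n, pderiv p i lo⟫ = 0)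
    (ν : ℝ) (hν : ν = ‖n‖)
    (v : Fin d → ℝ) (hv : ∀ j, v j = ⟪n, pderiv p j lr⟫) :
    Real.sqrt (∑ i, ((gram p lr)⁻¹.mulVec v i) ^ 2)
      ≤ K * Real.sqrt (d : ℝ) * ν * (etaMin (gram p lr))⁻¹ * ∑ i, |lr i - lo i| := by
  subst hν
  set A := gram p lr
  set S := ∑ i, |lr i - lo i|
  have hS : 0 ≤ S := Finset.sum_nonneg fun i _ => abs_nonneg _
  have hη : 0 < etaMin A := etaMin_pos hd hPD
  have hv_le (j : Fin d) : |v j| ≤ ‖n‖ * (K * S) := by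
    have hvj : v j = ⟪n, pderiv p j lr - pderiv p j lo⟫ := by
      rw [inner_sub_right, hn, sub_zero, hv]
    rw [hvj]
    exact (abs_real_inner_le_norm _ _).trans (mul_le_mul_of_nonneg_left
      (norm_sub_le_of_norm_pderiv_le (differentiable_pderiv hp j) fun i => hKb i j)
      (norm_nonneg n))
  have hmul : A *ᵥ (A⁻¹ *ᵥ v) = v := by
    rw [Matrix.mulVec_mulVec, Matrix.mul_nonsing_inv _ ((Matrix.isUnit_iff_isUnit_det A).1 hPD.isUnit),
      Matrix.one_mulVec]
  have hbound := (etaMin_mul_norm_le hPD.isHermitian hη.le (A⁻¹ *ᵥ v)).trans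
    (hmul.symm ▸ norm_toLp_le_sqrt_mul (by positivity) hv_le)
  have hnorm : √(∑ i, (A⁻¹ *ᵥ v) i ^ 2) = ‖WithLp.toLp 2 (A⁻¹ *ᵥ v)‖ := by
    simp [EuclideanSpace.norm_eq]
  rw [hnorm]
  calc ‖WithLp.toLp 2 (A⁻¹ *ᵥ v)‖ ≤ √d * (‖n‖ * (K * S)) / etaMin A := by
        rwa [le_div_iff₀' hη]
    _ = K * √d * ‖n‖ * (etaMin A)⁻¹ * S := by ring
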